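/- For any 1 ≤ k ≤ n, the width-k type-B Eulerian polynomial is gamma-positive: Σ_{π ∈ B_n} x^{des_k^B(π)} = Σ_{p=0}^{⌊(n-k+1)/2⌋} γ_{n,k,p}^B x^p (1+x)^{n-k+1-2p}, where γ_{n,k,p}^B = 2^{2p+k-1} · #{σ ∈ S_n : lpeak_k(σ) = p} and lpeak_k(σ) counts width-k left peaks of σ. -/

import Mathlib

open Finset

/-- The value function of the signed permutation determined by `σ` and sign vector `ε`:
`bval n σ ε i` is `π(i)` for `i ∈ {-n,…,n}`, with `π(0) = 0` and `π(-i) = -π(i)`. -/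
def bval (n : ℕ) (σ : Equiv.Perm (Fin n)) (ε : Fin n → Bool) : ℤ → ℤ := fun i =>
  if h : 1 ≤ i.natAbs ∧ i.natAbs ≤ n then
    (Int.sign i) *
      (if ε ⟨i.natAbs - 1, by omega⟩ then -((((σ ⟨i.natAbs - 1, by omega⟩ : Fin n) : ℕ) : ℤ) + 1)
       else (((σ ⟨i.natAbs - 1, by omega⟩ : Fin n) : ℕ) : ℤ) + 1)
  else 0

/-- width-`k` type-B descent number: `#{0 ≤ i ≤ n-k : π(i) > π(i+k)}`, `π(0)=0`. -/
def desB (n k : ℕ) (π : ℤ → ℤ) : ℕ :=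
  ((range (n - k + 1)).filter fun i : ℕ => π i > π ((i : ℤ) + k)).card

/-- width-`k` type-A descent number: `#{1 ≤ i ≤ n-k : π(i) > π(i+k)}`. -/
def desA (n k : ℕ) (π : ℤ → ℤ) : ℕ :=
  ((Icc 1 (n - k)).filter fun i : ℕ => π i > π ((i : ℤ) + k)).card

/-- width-`k` negative descent number: `#{1 ≤ i ≤ n-k : π(-i) > π(i+k)}`. -/
def ndesB (n k : ℕ) (π : ℤ → ℤ) : ℕ :=
  ((Icc 1 (n - k)).filter fun i : ℕ => π (-(i : ℤ)) > π ((i : ℤ) + k)).card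

/-- width-`k` inversion number: pairs `i < j` in `[n]` with `j - i` a positive multiple of `k`
and `π(i) > π(j)`. -/
def invAk (n k : ℕ) (π : ℤ → ℤ) : ℕ :=
  (((Icc 1 n) ×ˢ (Icc 1 n)).filter fun p : ℕ × ℕ =>
    p.1 < p.2 ∧ k ∣ (p.2 - p.1) ∧ π p.1 > π p.2).card

/-- width-`k` negative-entry statistic: `#{1 ≤ i ≤ ⌊n/k⌋ : π(ik) < 0}`. -/
def negk (n k : ℕ) (π : ℤ → ℤ) : ℕ :=
  ((Icc 1 (n / k)).filter fun i : ℕ => π ((i : ℤ) * k) < 0).card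

/-- width-`k` negative-sum-pair statistic. -/
def nspk (n k : ℕ) (π : ℤ → ℤ) : ℕ :=
  (((Icc 1 n) ×ˢ (Icc 1 n)).filter fun p : ℕ × ℕ =>
    p.1 < p.2 ∧ k ∣ (p.2 - p.1) ∧ π p.1 + π p.2 < 0).card

/-- width-`k` type-B inversion number. -/
def invBk (n k : ℕ) (π : ℤ → ℤ) : ℕ := invAk n k π + negk n k π + nspk n k π

/-- Number of width-`k` left peaks: indices `k ≤ i ≤ n-k` with `π(i-k) < π(i) > π(i+k)`,
convention `π(0) = 0`. -/
def lpeakk (n k : ℕ) (π : ℤ → ℤ) : ℕ :=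
  ((Finset.Icc k (n - k)).filter fun i : ℕ =>
    π ((i : ℤ) - k) < π i ∧ π i > π ((i : ℤ) + k)).card


lemma reindexEdges (n k : ℕ) (hk : 1 ≤ k) (hkn : k ≤ n) (P Q : ℕ → ℕ) (hQ : Q 0 = 0) :
    ∑ i ∈ range (n - k + 1), (P (i + k) + Q i) =
      ∑ j ∈ range n, ((if k ≤ j + 1 then P (j + 1) else 0) +
        (if j + 1 ≤ n - k then Q (j + 1) else 0)) := by
  rw [sum_add_distrib, sum_add_distrib, sum_range_succ' Q, hQ, add_zero]
  congr 1
  · rw [← sum_filter]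
    refine sum_bij' (fun i _ => i + k - 1) (fun j _ => j + 1 - k) ?_ ?_ ?_ ?_ ?_
    · intro i hi; simp at hi ⊢; omega
    · intro i hi; simp at hi ⊢; omega
    · intro i hi; simp at hi ⊢; omega
    · intro i hi; simp at hi ⊢; omega
    · intro i hi; congr 1; omega
  · rw [← sum_filter]
    congr 1
    ext j; simp; omega

lemma bval_nat (n : ℕ) (σ : Equiv.Perm (Fin n)) (ε : Fin n → Bool) (v : Fin n) :
    bval n σ ε (((v : ℕ) + 1 : ℕ) : ℤ) =
      if ε v then -((((σ v : Fin n) : ℕ) : ℤ) + 1) else (((σ v : Fin n) : ℕ) : ℤ) + 1 := by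
  have h1 : Int.natAbs (((v : ℕ) + 1 : ℕ) : ℤ) = v + 1 := by simp only [Int.natAbs_natCast]
  have h2 : Int.sign (((v : ℕ) + 1 : ℕ) : ℤ) = 1 := Int.sign_eq_one_of_pos (by positivity)
  have h3 : (1 ≤ (v : ℕ) + 1 ∧ (v : ℕ) + 1 ≤ n) := by omega
  unfold bval
  simp only [h1, h2, h3, one_mul]
  simp

lemma bval_zero (n : ℕ) (σ : Equiv.Perm (Fin n)) (ε : Fin n → Bool) : bval n σ ε 0 = 0 := by
  simp [bval]

/-- The unsigned sequence. -/
def absSeq (n : ℕ) (σ : Equiv.Perm (Fin n)) (j : ℕ) : ℤ := bval n σ (fun _ => false) j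

/-- The sign at position `j`, extended to the natural numbers. -/
def sgnSeq (n : ℕ) (ε : Fin n → Bool) (j : ℕ) : Bool :=
  if h : 1 ≤ j ∧ j ≤ n then ε ⟨j - 1, by omega⟩ else false

lemma bval_eq (n : ℕ) (σ : Equiv.Perm (Fin n)) (ε : Fin n → Bool) (j : ℕ) (hj : j ≤ n) :
    bval n σ ε (j : ℤ) = if sgnSeq n ε j then - absSeq n σ j else absSeq n σ j := by
  rcases j with _ | j
  · simp [absSeq, bval_zero]
  · have e := bval_nat n σ ε ⟨j, hj⟩
    have e' := bval_nat n σ (fun _ => false) ⟨j, hj⟩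
    simp only at e e'
    rw [e, absSeq, e']
    have : sgnSeq n ε (j + 1) = ε ⟨j, hj⟩ := by
      unfold sgnSeq
      rw [dif_pos (by omega)]; rfl
    simp [this]

lemma absSeq_zero (n : ℕ) (σ : Equiv.Perm (Fin n)) : absSeq n σ 0 = 0 := by
  simp [absSeq, bval_zero]

lemma absSeq_succ (n : ℕ) (σ : Equiv.Perm (Fin n)) (j : ℕ) (hj : j < n) :
    absSeq n σ (j + 1) = (σ ⟨j, hj⟩ : ℕ) + 1 := by
  have e' := bval_nat n σ (fun _ => false) ⟨j, hj⟩
  simp only at e'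
  rw [absSeq, e']; simp

lemma absSeq_nonneg (n : ℕ) (σ : Equiv.Perm (Fin n)) (j : ℕ) (hj : j ≤ n) :
    0 ≤ absSeq n σ j := by
  rcases j with _ | j
  · simp [absSeq_zero]
  · rw [absSeq_succ n σ j hj]; positivity

lemma absSeq_ne (n : ℕ) (σ : Equiv.Perm (Fin n)) (i j : ℕ) (hi : i < j) (hj : j ≤ n) :
    absSeq n σ i ≠ absSeq n σ j := by
  rcases j with _ | j
  · omega
  rw [absSeq_succ n σ j hj]
  rcases i with _ | i
  · rw [absSeq_zero]; positivity
  · rw [absSeq_succ n σ i (by omega)]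
    intro h
    have h2 : (σ ⟨i, by omega⟩ : ℕ) = (σ ⟨j, hj⟩ : ℕ) := by exact_mod_cast add_right_cancel h
    have := σ.injective (Fin.ext h2)
    simp at this; omega

/-- left edge owned -/
def ownL (n k : ℕ) (σ : Equiv.Perm (Fin n)) (j : ℕ) : Prop :=
  k ≤ j ∧ absSeq n σ (j - k) < absSeq n σ j

/-- right edge owned -/
def ownR (n k : ℕ) (σ : Equiv.Perm (Fin n)) (j : ℕ) : Prop :=
  j ≤ n - k ∧ absSeq n σ (j + k) < absSeq n σ j

instance (n k : ℕ) (σ : Equiv.Perm (Fin n)) (j : ℕ) : Decidable (ownL n k σ j) :=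
  inferInstanceAs (Decidable (_ ∧ _))

instance (n k : ℕ) (σ : Equiv.Perm (Fin n)) (j : ℕ) : Decidable (ownR n k σ j) :=
  inferInstanceAs (Decidable (_ ∧ _))

lemma ownL_iff (n k : ℕ) (σ : Equiv.Perm (Fin n)) (j : ℕ) :
    ownL n k σ j ↔ k ≤ j ∧ absSeq n σ (j - k) < absSeq n σ j := Iff.rfl

lemma ownR_iff (n k : ℕ) (σ : Equiv.Perm (Fin n)) (j : ℕ) :
    ownR n k σ j ↔ j ≤ n - k ∧ absSeq n σ (j + k) < absSeq n σ j := Iff.rfl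

/-- contribution of a vertex to the descent number -/
def contrib (n k : ℕ) (σ : Equiv.Perm (Fin n)) (j : ℕ) (b : Bool) : ℕ :=
  (if ownL n k σ j ∧ b = true then 1 else 0) + (if ownR n k σ j ∧ b = false then 1 else 0)

lemma desB_eq (n k : ℕ) (hk : 1 ≤ k) (hkn : k ≤ n) (σ : Equiv.Perm (Fin n)) (ε : Fin n → Bool) :
    desB n k (bval n σ ε) = ∑ v : Fin n, contrib n k σ (v + 1) (ε v) := by
  have h := reindexEdges n k hk hkn
    (fun j => if absSeq n σ (j - k) < absSeq n σ j ∧ sgnSeq n ε j = true then 1 else 0)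
    (fun j => if absSeq n σ (j + k) < absSeq n σ j ∧ sgnSeq n ε j = false then 1 else 0)
    (by
      have := absSeq_nonneg n σ k hkn
      simp [absSeq_zero]; intro h; omega)
  have hv : ∑ v : Fin n, contrib n k σ (v + 1) (ε v) =
      ∑ v : Fin n, contrib n k σ (v + 1) (sgnSeq n ε (v + 1)) := by
    refine sum_congr rfl fun v _ => ?_
    congr 1
    unfold sgnSeq
    rw [dif_pos (by omega)]; rfl
  rw [hv, Fin.sum_univ_eq_sum_range (fun j => contrib n k σ (j + 1) (sgnSeq n ε (j + 1))) n]
  refine Eq.trans ?_ (h.trans (sum_congr rfl fun j _ => ?_))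
  swap
  · simp only [contrib, ownL_iff, ownR_iff, and_assoc, ite_and]
  unfold desB
  rw [card_filter]
  refine sum_congr rfl fun i hi => ?_
  simp only [mem_range] at hi
  have e1 := bval_eq n σ ε i (by omega)
  have e2 := bval_eq n σ ε (i + k) (by omega)
  push_cast at e2
  have n1 := absSeq_nonneg n σ i (by omega)
  have n2 := absSeq_nonneg n σ (i + k) (by omega)
  have n3 := absSeq_ne n σ i (i + k) (by omega) (by omega)
  rw [e1, e2, Nat.add_sub_cancel]
  cases sgnSeq n ε i <;> cases sgnSeq n ε (i + k) <;> simp <;> grind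

lemma edges_eq (n k : ℕ) (hk : 1 ≤ k) (hkn : k ≤ n) (σ : Equiv.Perm (Fin n)) :
    n - k + 1 = ∑ j ∈ range n, ((if ownL n k σ (j + 1) then 1 else 0) +
      (if ownR n k σ (j + 1) then 1 else 0)) := by
  have h := reindexEdges n k hk hkn
    (fun j => if absSeq n σ (j - k) < absSeq n σ j then 1 else 0)
    (fun j => if absSeq n σ (j + k) < absSeq n σ j then 1 else 0)
    (by
      have := absSeq_nonneg n σ k hkn
      simp [absSeq_zero]; omega)
  refine Eq.trans ?_ (h.trans (sum_congr rfl fun j _ => ?_))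
  swap
  · simp only [ownL_iff, ownR_iff, ite_and]
  trans ∑ i ∈ range (n - k + 1), 1
  · simp
  refine sum_congr rfl fun i hi => ?_
  simp only [mem_range] at hi
  have n3 := absSeq_ne n σ i (i + k) (by omega) (by omega)
  rw [Nat.add_sub_cancel]
  split_ifs <;> omega

lemma lpeak_eq (n k : ℕ) (hk : 1 ≤ k) (hkn : k ≤ n) (σ : Equiv.Perm (Fin n)) :
    lpeakk n k (bval n σ fun _ => false) =
      ∑ j ∈ range n, if ownL n k σ (j + 1) ∧ ownR n k σ (j + 1) then 1 else 0 := by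
  unfold lpeakk
  rw [← card_filter]
  refine card_bij' (fun i _ => i - 1) (fun j _ => j + 1) ?_ ?_ ?_ ?_
  · intro i hi
    rw [mem_filter] at hi ⊢
    simp only [mem_Icc, mem_range, ownL_iff, ownR_iff, absSeq] at hi ⊢
    obtain ⟨⟨h1, h2⟩, h3, h4⟩ := hi
    rw [Nat.sub_add_cancel (by omega)]
    rw [Nat.cast_sub h1, Nat.cast_add]
    exact ⟨by omega, ⟨h1, h3⟩, h2, h4⟩
  · intro j hj
    rw [mem_filter] at hj ⊢
    simp only [mem_Icc, mem_range, ownL_iff, ownR_iff, absSeq] at hj ⊢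
    obtain ⟨h0, ⟨h1, h2⟩, h3, h4⟩ := hj
    rw [Nat.cast_sub h1] at h2
    rw [Nat.cast_add (j + 1) k] at h4
    exact ⟨⟨h1, h3⟩, h2, h4⟩
  · intro i hi
    simp at hi ⊢; omega
  · intro j hj
    simp

lemma sum_signs (n k : ℕ) (hk : 1 ≤ k) (hkn : k ≤ n) (R : Type*) [CommRing R] (x : R)
    (σ : Equiv.Perm (Fin n)) (p : ℕ) (hp : lpeakk n k (bval n σ fun _ => false) = p) :
    2 * p ≤ n - k + 1 ∧ ∑ ε : Fin n → Bool, x ^ desB n k (bval n σ ε) =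
      2 ^ (2 * p + k - 1) * x ^ p * (1 + x) ^ (n - k + 1 - 2 * p) := by
  rw [lpeak_eq n k hk hkn] at hp
  have hm := edges_eq n k hk hkn σ
  set A : ℕ → ℕ := fun j => if ownL n k σ (j + 1) ∧ ownR n k σ (j + 1) then 1 else 0 with hA
  set B : ℕ → ℕ := fun j => if ¬ (ownL n k σ (j + 1) ↔ ownR n k σ (j + 1)) then 1 else 0 with hB
  set C : ℕ → ℕ := fun j => if ¬ ownL n k σ (j + 1) ∧ ¬ ownR n k σ (j + 1) then 1 else 0 with hC
  have h1 : ∑ j ∈ range n, (A j + B j + C j) = n := by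
    trans ∑ j ∈ range n, 1
    · refine sum_congr rfl fun j _ => ?_
      by_cases hL : ownL n k σ (j + 1) <;> by_cases hR : ownR n k σ (j + 1) <;>
        simp [hA, hB, hC, hL, hR]
    · simp
  have h2 : ∑ j ∈ range n, (2 * A j + B j) = n - k + 1 := by
    rw [hm]
    refine sum_congr rfl fun j _ => ?_
    by_cases hL : ownL n k σ (j + 1) <;> by_cases hR : ownR n k σ (j + 1) <;>
        simp [hA, hB, hL, hR]
  rw [sum_add_distrib, sum_add_distrib, hp] at h1
  rw [sum_add_distrib, ← mul_sum, hp] at h2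
  refine ⟨by omega, ?_⟩
  have h3 : ∑ ε : Fin n → Bool, x ^ desB n k (bval n σ ε) =
      ∏ v : Fin n, ∑ b : Bool, x ^ contrib n k σ (v + 1) b := by
    rw [Finset.prod_univ_sum, Fintype.piFinset_univ]
    refine sum_congr rfl fun ε _ => ?_
    rw [desB_eq n k hk hkn, prod_pow_eq_pow_sum]
  rw [h3, Fin.prod_univ_eq_prod_range (fun j => ∑ b : Bool, x ^ contrib n k σ (j + 1) b) n]
  have h4 : ∀ j ∈ range n, ∑ b : Bool, x ^ contrib n k σ (j + 1) b =
      (2 * x) ^ A j * (1 + x) ^ B j * 2 ^ C j := by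
    intro j _
    by_cases hL : ownL n k σ (j + 1) <;> by_cases hR : ownR n k σ (j + 1) <;>
        simp [hA, hB, hC, hL, hR, contrib] <;> ring
  rw [prod_congr rfl h4, prod_mul_distrib, prod_mul_distrib, prod_pow_eq_pow_sum,
    prod_pow_eq_pow_sum, prod_pow_eq_pow_sum, hp]
  have hq : ∑ j ∈ range n, B j = n - k + 1 - 2 * p := by omega
  have hr : ∑ j ∈ range n, C j = p + k - 1 := by omega
  have hs : 2 * p + k - 1 = p + (p + k - 1) := by omega
  rw [hq, hr, hs, mul_pow, pow_add]
  ring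

/-- Theorem 17: gamma-positivity of the width-`k` type-B Eulerian
polynomial, with `γ_{n,k,p}^B = 2^{2p+k-1} · #{σ ∈ S_n : lpeak_k(σ) = p}`. -/
theorem stmt10 (n k : ℕ) (hk : 1 ≤ k) (hkn : k ≤ n) (R : Type*) [CommRing R] (x : R) :
    ∑ σ : Equiv.Perm (Fin n), ∑ ε : Fin n → Bool, x ^ desB n k (bval n σ ε) =
      ∑ p ∈ Finset.range ((n - k + 1) / 2 + 1),
        ((2 ^ (2 * p + k - 1) *
            Fintype.card {σ : Equiv.Perm (Fin n) //
              lpeakk n k (bval n σ fun _ => false) = p} : ℕ) : R) *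
          x ^ p * (1 + x) ^ (n - k + 1 - 2 * p) := by
  have key := fun σ => sum_signs n k hk hkn R x σ _ rfl
  rw [sum_congr rfl fun σ _ => (key σ).2]
  have h1 : ∀ p ∈ Finset.range ((n - k + 1) / 2 + 1),
      ((2 ^ (2 * p + k - 1) * Fintype.card {σ : Equiv.Perm (Fin n) //
              lpeakk n k (bval n σ fun _ => false) = p} : ℕ) : R) *
          x ^ p * (1 + x) ^ (n - k + 1 - 2 * p) =
      ∑ σ : Equiv.Perm (Fin n), if lpeakk n k (bval n σ fun _ => false) = p then
        (2 ^ (2 * p + k - 1) * x ^ p * (1 + x) ^ (n - k + 1 - 2 * p) : R) else 0 := by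
    intro p _
    rw [← sum_filter, sum_const, Fintype.card_subtype, nsmul_eq_mul]
    push_cast
    ring
  rw [sum_congr rfl h1, sum_comm]
  refine sum_congr rfl fun σ _ => ?_
  rw [sum_ite_eq, if_pos]
  have := (key σ).1
  simp only [mem_range]
  omega
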